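/- Let γ ∈ [1/2, 1), K ≥ 0 and N ≥ 0, and let f : (0,1] → [0,∞) be a function such that f(r) ≤ N for all r ∈ (0,1] and f(r) ≤ γ·f(2r) + K·r² whenever 0 < r and 2r ≤ 1. Then, with α := −(log γ)/(2·log 2) ∈ (0, 1/2], one has f(r) ≤ 4·(N + K)·r^{2α} for all r ∈ (0,1]. -/

import Mathlib

/-- A function bounded by `M` on `(0,1]` that contracts by the factor `2 ^ (-β)` from scale `2r`
to scale `r` decays like `r ^ β`. -/
theorem le_mul_rpow_of_le_mul_two_mul {β M : ℝ} (hβ : 0 ≤ β) (hM : 0 ≤ M) {g : ℝ → ℝ}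
    (hgM : ∀ r : ℝ, 0 < r → r ≤ 1 → g r ≤ M)
    (hg : ∀ r : ℝ, 0 < r → 2 * r ≤ 1 → g r ≤ (2 : ℝ) ^ (-β) * g (2 * r))
    {r : ℝ} (hr₀ : 0 < r) (hr₁ : r ≤ 1) : g r ≤ (2 : ℝ) ^ β * M * r ^ β := by
  have large : ∀ s : ℝ, 1 / 2 < s → s ≤ 1 → g s ≤ (2 : ℝ) ^ β * M * s ^ β := by
    intro s hs hs₁
    have h1 : 1 ≤ (2 : ℝ) ^ β * s ^ β := by
      rw [← Real.mul_rpow (by norm_num) (by linarith)]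
      exact Real.one_le_rpow (by linarith) hβ
    calc g s ≤ M := hgM s (by linarith) hs₁
      _ ≤ M * ((2 : ℝ) ^ β * s ^ β) := le_mul_of_one_le_right hM h1
      _ = (2 : ℝ) ^ β * M * s ^ β := by ring
  have dyadic : ∀ (n : ℕ) (s : ℝ), 0 < s → s ≤ 1 → 1 / 2 < 2 ^ n * s →
      g s ≤ (2 : ℝ) ^ β * M * s ^ β := by
    intro n
    induction n with
    | zero => exact fun s _ hs₁ hs => large s (by simpa using hs) hs₁
    | succ n ih =>
      intro s hs₀ hs₁ hs
      rcases lt_or_ge (1 / 2) s with h | h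
      · exact large s h hs₁
      · calc g s ≤ (2 : ℝ) ^ (-β) * g (2 * s) := hg s hs₀ (by linarith)
          _ ≤ (2 : ℝ) ^ (-β) * ((2 : ℝ) ^ β * M * (2 * s) ^ β) := by
            gcongr
            exact ih (2 * s) (by linarith) (by linarith) (by rwa [← mul_assoc, ← pow_succ])
          _ = (2 : ℝ) ^ β * M * s ^ β := by
            rw [Real.mul_rpow (by norm_num) hs₀.le, Real.rpow_neg (by norm_num)]
            field_simp
  obtain ⟨n, hn⟩ := pow_unbounded_of_one_lt (1 / 2 / r) (one_lt_two (α := ℝ))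
  exact dyadic n r hr₀ hr₁ ((div_lt_iff₀ hr₀).1 hn)


/-- Dyadic iteration lemma: if `f : (0,1] → [0,∞)` is bounded by `N` and satisfies
`f r ≤ γ f (2r) + K r²` for `γ ∈ [1/2, 1)`, then with
`α := -(log γ)/(2 log 2) ∈ (0, 1/2]` one has `f r ≤ 4 (N + K) r^(2α)`. -/
theorem dyadic_iteration (γ K N : ℝ) (hγ₁ : 1 / 2 ≤ γ) (hγ₂ : γ < 1)
    (hK : 0 ≤ K) (hN : 0 ≤ N) (f : ℝ → ℝ)
    (hf0 : ∀ r : ℝ, 0 < r → r ≤ 1 → 0 ≤ f r)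
    (hfN : ∀ r : ℝ, 0 < r → r ≤ 1 → f r ≤ N)
    (hiter : ∀ r : ℝ, 0 < r → 2 * r ≤ 1 → f r ≤ γ * f (2 * r) + K * r ^ 2) :
    (0 < -(Real.log γ) / (2 * Real.log 2) ∧ -(Real.log γ) / (2 * Real.log 2) ≤ 1 / 2) ∧
    ∀ r : ℝ, 0 < r → r ≤ 1 →
      f r ≤ 4 * (N + K) * r ^ (2 * (-(Real.log γ) / (2 * Real.log 2))) := by
  have hγ₀ : 0 < γ := by linarith
  have hlog2 : 0 < Real.log 2 := Real.log_pos one_lt_two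
  have hlogγ : Real.log γ < 0 := Real.log_neg hγ₀ hγ₂
  have hloglb : -Real.log 2 ≤ Real.log γ := by
    rw [← Real.log_inv]
    exact Real.log_le_log (by norm_num) (by linarith)
  have hα₀ : 0 < -(Real.log γ) / (2 * Real.log 2) := div_pos (by linarith) (by linarith)
  refine ⟨⟨hα₀, ?_⟩, fun r hr₀ hr₁ => ?_⟩
  · rw [div_le_iff₀ (by linarith)]
    linarith
  set β := 2 * (-(Real.log γ) / (2 * Real.log 2)) with hβ
  have hpow : (2 : ℝ) ^ (-β) = γ := by
    have hmul : Real.log 2 * -β = Real.log γ := by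
      rw [hβ]
      field_simp
    rw [Real.rpow_def_of_pos two_pos, hmul, Real.exp_log hγ₀]
  have hpow' : (2 : ℝ) ^ β ≤ 2 := by
    rw [← neg_neg β, Real.rpow_neg two_pos.le, hpow]
    exact inv_le_of_inv_le₀ two_pos (by linarith)
  obtain ⟨c, hc⟩ : ∃ c, c = K / (4 * γ - 1) := ⟨_, rfl⟩
  have hcK : c * (4 * γ - 1) = K := by
    rw [hc, div_mul_cancel₀ _ (by linarith)]
  have hc₀ : 0 ≤ c := hc ▸ div_nonneg hK (by linarith)
  have hcle : c ≤ K := by nlinarith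
  have hg := le_mul_rpow_of_le_mul_two_mul (β := β) (M := N + K) (g := fun s => f s + c * s ^ 2)
    (by positivity) (by positivity)
    (fun s hs₀ hs₁ => by
      have : c * s ^ 2 ≤ c := mul_le_of_le_one_right hc₀ (pow_le_one₀ hs₀.le hs₁)
      linarith [hfN s hs₀ hs₁])
    (fun s hs₀ hs₁ => by
      rw [hpow]
      refine (add_le_add_left (hiter s hs₀ hs₁) _).trans_eq ?_
      rw [← hcK]
      ring)
    hr₀ hr₁
  calc f r ≤ f r + c * r ^ 2 := le_add_of_nonneg_right (by positivity)
    _ ≤ (2 : ℝ) ^ β * (N + K) * r ^ β := hg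
    _ ≤ 4 * (N + K) * r ^ β := by
      gcongr
      linarith
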